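/- arXiv:2512.15535 — 3 statements merged into one kernel-verified Lean document; each statement's English description precedes it below -/
import Mathlib

section
/- Let ν be a Borel probability measure on ℝ whose topological support is contained in [0,∞), and let F(ξ) := ν((−∞, ξ]) be its cumulative distribution function. Let b : ℝ → ℝ be continuously differentiable with compact support and set B(ξ) := ∫_{(ξ,∞)} b(η) dη, so that B'(ξ) = −b(ξ). Then ∫_ℝ (ξ·B'(ξ) − B(ξ)) dν(ξ) = ∫_ℝ ξ·b'(ξ)·F(ξ) dξ, equivalently ∫_ℝ (−ξ·b(ξ) − B(ξ)) dν(ξ) = ∫_ℝ ξ·b'(ξ)·F(ξ) dξ, where the right-hand integral is with respect to Lebesgue measure. -/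
open MeasureTheory Set

/-- The topological support of a measure: the set of points all of whose
neighbourhoods have positive measure. -/
def measureSupport (ν : MeasureTheory.Measure ℝ) : Set ℝ :=
  {x : ℝ | ∀ U ∈ nhds x, 0 < ν U}

/-- Fubini: integrating the tails of `g` against `μ` is the same as integrating `g` against the
cumulative distribution function of `μ`. -/
theorem integral_integral_Ioi_eq_integral_mul_measureReal_Iic (μ : Measure ℝ) [IsFiniteMeasure μ]
    {g : ℝ → ℝ} (hg : Integrable g) :
    ∫ ξ, (∫ η in Ioi ξ, g η) ∂μ = ∫ η, g η * μ.real (Iic η) := by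
  have hs : MeasurableSet {p : ℝ × ℝ | p.1 ≤ p.2} := measurableSet_le measurable_fst measurable_snd
  have hint : Integrable (Function.uncurry fun ξ η : ℝ => (Ici ξ).indicator g η)
      (μ.prod volume) := (hg.comp_snd μ).indicator hs
  calc ∫ ξ, (∫ η in Ioi ξ, g η) ∂μ = ∫ ξ, (∫ η, (Ici ξ).indicator g η) ∂μ := by
        simp_rw [integral_indicator measurableSet_Ici, integral_Ici_eq_integral_Ioi]
    _ = ∫ η, ∫ ξ, (Iic η).indicator (fun _ => g η) ξ ∂μ := integral_integral_swap hint
    _ = ∫ η, g η * μ.real (Iic η) := by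
        simp_rw [integral_indicator_const _ measurableSet_Iic, smul_eq_mul, mul_comm]

theorem hasDerivAt_integral_Ioi {b : ℝ → ℝ} (hb : Continuous b) (hbi : Integrable b) (ξ : ℝ) :
    HasDerivAt (fun x => ∫ η in Ioi x, b η) (-b ξ) ξ := by
  have h : (fun x => ∫ η in Ioi x, b η) = fun x => (∫ η in Ioi 0, b η) - ∫ η in (0 : ℝ)..x, b η := by
    funext x
    linarith [intervalIntegral.integral_Ioi_sub_Ioi' (a := 0) (b := x) (f := b) (μ := volume)
      hbi.integrableOn hbi.integrableOn]
  rw [h]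
  exact (hb.integral_hasStrictDerivAt 0 ξ).hasDerivAt.const_sub _

theorem integral_Ioi_mul_deriv {b : ℝ → ℝ} (hb : ContDiff ℝ 1 b) (hbs : HasCompactSupport b)
    (ξ : ℝ) : ∫ η in Ioi ξ, η * deriv b η = -(ξ * b ξ) - ∫ η in Ioi ξ, b η := by
  have hbi : Integrable b := hb.continuous.integrable_of_hasCompactSupport hbs
  have hgi : Integrable fun η => η * deriv b η :=
    (continuous_id.mul (hb.continuous_deriv le_rfl)).integrable_of_hasCompactSupport
      hbs.deriv.mul_left
  have hderiv : deriv (fun η => η * b η) = fun η => b η + η * deriv b η := by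
    funext η
    simpa using
      ((hasDerivAt_id' η).fun_mul (hb.differentiable one_ne_zero η).hasDerivAt).deriv
  have h := HasCompactSupport.integral_Ioi_deriv_eq (f := fun η => η * b η)
    (contDiff_id.mul hb) hbs.mul_left ξ
  rw [hderiv, integral_add hbi.integrableOn hgi.integrableOn] at h
  linarith

/-- Let `ν` be a Borel probability measure on `ℝ` whose
topological support is contained in `[0,∞)`, with cumulative distribution function
`F ξ := ν (Iic ξ)`. Let `b : ℝ → ℝ` be continuously differentiable with compact
support and set `B ξ := ∫_{(ξ,∞)} b(η) dη`, so that `B' ξ = -b ξ`. Then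
`∫ (ξ B'(ξ) - B ξ) dν = ∫ ξ b'(ξ) F ξ dξ`, equivalently
`∫ (-ξ b(ξ) - B ξ) dν = ∫ ξ b'(ξ) F ξ dξ`, the right-hand integral being with
respect to Lebesgue measure. -/
theorem stmt11 (ν : Measure ℝ) [IsProbabilityMeasure ν]
    (hsupp : measureSupport ν ⊆ Set.Ici 0)
    (F : ℝ → ℝ) (hF : ∀ ξ : ℝ, F ξ = (ν (Set.Iic ξ)).toReal)
    (b : ℝ → ℝ) (hb : ContDiff ℝ 1 b) (hbsupp : HasCompactSupport b)
    (B : ℝ → ℝ) (hB : ∀ ξ : ℝ, B ξ = ∫ η in Set.Ioi ξ, b η) :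
    (∫ ξ, (ξ * deriv B ξ - B ξ) ∂ν = ∫ ξ, ξ * deriv b ξ * F ξ) ∧
    (∫ ξ, (-(ξ * b ξ) - B ξ) ∂ν = ∫ ξ, ξ * deriv b ξ * F ξ) := by
  have hgi : Integrable fun η => η * deriv b η :=
    (continuous_id.mul (hb.continuous_deriv le_rfl)).integrable_of_hasCompactSupport
      hbsupp.deriv.mul_left
  have hmain : ∫ ξ, (-(ξ * b ξ) - B ξ) ∂ν = ∫ ξ, ξ * deriv b ξ * F ξ := by
    simp_rw [hB, hF, ← integral_Ioi_mul_deriv hb hbsupp]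
    exact integral_integral_Ioi_eq_integral_mul_measureReal_Iic ν hgi
  have hderiv (ξ : ℝ) : deriv B ξ = -b ξ := by
    rw [funext hB]
    exact (hasDerivAt_integral_Ioi hb.continuous
      (hb.continuous.integrable_of_hasCompactSupport hbsupp) ξ).deriv
  refine ⟨?_, hmain⟩
  simp_rw [hderiv, mul_neg]
  exact hmain
end

section
/- Let ν be a Borel probability measure on ℝ whose topological support is contained in [0,∞), and let h : ℝ → [0,∞) be continuous with ∫_ℝ h dν < ∞. Let b : ℝ → ℝ be continuously differentiable with compact support and set B(ξ) := ∫_{(ξ,∞)} b(η) dη, so that B'(ξ) = −b(ξ). Then ∫_ℝ (ξ·B'(ξ) − B(ξ))·h(ξ) dν(ξ) = ∫_ℝ ξ·b'(ξ)·( ∫_{(−∞,ξ]} h(η) dν(η) ) dξ, where the outer integral on the right-hand side is with respect to Lebesgue measure. -/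
open MeasureTheory Set

/-- Integration by parts against the identity on a half-line, for a compactly supported
`C¹` function. -/
theorem HasCompactSupport.integral_Ici_mul_deriv {b : ℝ → ℝ} (hb : ContDiff ℝ 1 b)
    (hbsupp : HasCompactSupport b) (a : ℝ) :
    ∫ ξ in Ici a, ξ * deriv b ξ = -(a * b a) - ∫ ξ in Ioi a, b ξ := by
  have hbi : Integrable b := hb.continuous.integrable_of_hasCompactSupport hbsupp
  have hdi : Integrable fun ξ => ξ * deriv b ξ :=
    (continuous_id.mul (hb.continuous_deriv le_rfl)).integrable_of_hasCompactSupport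
      hbsupp.deriv.mul_left
  have hderiv : (deriv fun ξ => ξ * b ξ) = fun ξ => b ξ + ξ * deriv b ξ := by
    funext ξ
    simpa using ((hasDerivAt_id' ξ).fun_mul
      (hb.differentiable one_ne_zero ξ).hasDerivAt).deriv
  have hprod : ∫ ξ in Ioi a, deriv (fun ξ => ξ * b ξ) ξ = -(a * b a) :=
    HasCompactSupport.integral_Ioi_deriv_eq (contDiff_id.mul hb) hbsupp.mul_left a
  rw [hderiv, integral_add hbi.integrableOn hdi.integrableOn] at hprod
  rw [integral_Ici_eq_integral_Ioi]
  linarith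

/-- Fubini on the half-plane `η ≤ ξ`. -/
theorem MeasureTheory.integral_mul_setIntegral_Iic {μ ν : Measure ℝ} [SFinite μ] [SFinite ν]
    {f g : ℝ → ℝ} (hf : Integrable f μ) (hg : Integrable g ν) :
    ∫ ξ, f ξ * (∫ η in Iic ξ, g η ∂ν) ∂μ = ∫ η, (∫ ξ in Ici η, f ξ ∂μ) * g η ∂ν := by
  have hint : Integrable (fun p : ℝ × ℝ =>
      {q : ℝ × ℝ | q.2 ≤ q.1}.indicator (fun q => f q.1 * g q.2) p) (μ.prod ν) :=
    (hf.mul_prod hg).indicator (measurableSet_le measurable_snd measurable_fst)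
  calc ∫ ξ, f ξ * (∫ η in Iic ξ, g η ∂ν) ∂μ
      = ∫ ξ, ∫ η, {q : ℝ × ℝ | q.2 ≤ q.1}.indicator (fun q => f q.1 * g q.2) (ξ, η) ∂ν ∂μ := by
        congr with ξ
        rw [← integral_indicator measurableSet_Iic, ← integral_const_mul]
        congr with η
        by_cases hη : η ≤ ξ <;> simp [hη]
    _ = ∫ η, ∫ ξ, {q : ℝ × ℝ | q.2 ≤ q.1}.indicator (fun q => f q.1 * g q.2) (ξ, η) ∂μ ∂ν :=
        integral_integral_swap hint
    _ = ∫ η, (∫ ξ in Ici η, f ξ ∂μ) * g η ∂ν := by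
        congr with η
        rw [← integral_indicator measurableSet_Ici, ← integral_mul_const]
        congr with ξ
        by_cases hη : η ≤ ξ <;> simp [hη]

/-- Let `ν` be a Borel probability measure on `ℝ` whose
topological support is contained in `[0,∞)`, and let `h : ℝ → [0,∞)` be continuous
with `∫ h dν < ∞`. Let `b : ℝ → ℝ` be continuously differentiable with compact
support and set `B ξ := ∫_{(ξ,∞)} b(η) dη`, so that `B' ξ = -b ξ`. Then
`∫ (ξ B'(ξ) - B ξ) h(ξ) dν = ∫ ξ b'(ξ) (∫_{(-∞,ξ]} h dν) dξ`, i.e. (using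
`B' = -b`) `∫ (-ξ b(ξ) - B ξ) h(ξ) dν = ∫ ξ b'(ξ) (∫_{(-∞,ξ]} h dν) dξ`, where
the outer integral on the right-hand side is with respect to Lebesgue measure. -/
theorem stmt12 (ν : Measure ℝ) [IsProbabilityMeasure ν]
    (hsupp : measureSupport ν ⊆ Set.Ici 0)
    (h : ℝ → ℝ) (hhc : Continuous h) (hhnn : ∀ ξ : ℝ, 0 ≤ h ξ)
    (hhint : Integrable h ν)
    (b : ℝ → ℝ) (hb : ContDiff ℝ 1 b) (hbsupp : HasCompactSupport b)
    (B : ℝ → ℝ) (hB : ∀ ξ : ℝ, B ξ = ∫ η in Set.Ioi ξ, b η) :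
    ∫ ξ, (-(ξ * b ξ) - B ξ) * h ξ ∂ν
      = ∫ ξ, ξ * deriv b ξ * (∫ η in Set.Iic ξ, h η ∂ν) := by
  have hdi : Integrable fun ξ => ξ * deriv b ξ :=
    (continuous_id.mul (hb.continuous_deriv le_rfl)).integrable_of_hasCompactSupport
      hbsupp.deriv.mul_left
  rw [integral_mul_setIntegral_Iic hdi hhint]
  congr with ξ
  rw [HasCompactSupport.integral_Ici_mul_deriv hb hbsupp, hB]
end

section
/- Let T > 0, C > 0, and let g : (0,T) → [0,∞] be measurable. Suppose that for every smooth function η : ℝ → ℝ with compact support contained in (0,T) and satisfying 0 ≤ η ≤ 1, one has ∫₀^T η(t)·g(t) dt ≤ C·( sup_{t} |η(t)| + ∫₀^T |η'(t)| dt ). Then ∫₀^T g(t) dt ≤ 3C. -/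
open Filter Set MeasureTheory
open scoped ENNReal

/-- The variation on `(0, T)` of the product of an increasing and a decreasing `C¹` function, both
with values in `[0, 1]`, is at most `2`. -/
theorem integral_abs_deriv_mul_le_two {T : ℝ} (hT : 0 ≤ T) {a b : ℝ → ℝ}
    (ha : ContDiff ℝ 1 a) (hb : ContDiff ℝ 1 b) (ha_mono : Monotone a) (hb_anti : Antitone b)
    (ha0 : ∀ t, 0 ≤ a t) (ha1 : ∀ t, a t ≤ 1) (hb0 : ∀ t, 0 ≤ b t) (hb1 : ∀ t, b t ≤ 1) :
    ∫ t in Set.Ioo 0 T, |deriv (fun t => a t * b t) t| ≤ 2 := by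
  have hda : Differentiable ℝ a := ha.differentiable one_ne_zero
  have hdb : Differentiable ℝ b := hb.differentiable one_ne_zero
  have hca : Continuous (deriv a) := ha.continuous_deriv le_rfl
  have hcb : Continuous (deriv b) := hb.continuous_deriv le_rfl
  have hcab : Continuous (deriv fun t => a t * b t) := (ha.mul hb).continuous_deriv le_rfl
  have hle : ∀ t, |deriv (fun t => a t * b t) t| ≤ deriv a t - deriv b t := fun t => by
    have h1 : 0 ≤ deriv a t := ha_mono.deriv_nonneg
    have h2 : deriv b t ≤ 0 := hb_anti.deriv_nonpos
    rw [((hda t).hasDerivAt.fun_mul (hdb t).hasDerivAt).deriv, abs_le]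
    constructor <;>
      nlinarith [mul_nonneg h1 (hb0 t), mul_nonneg h1 (sub_nonneg.2 (hb1 t)),
        mul_nonneg (ha0 t) (neg_nonneg.2 h2),
        mul_nonneg (sub_nonneg.2 (ha1 t)) (neg_nonneg.2 h2)]
  rw [← integral_Ioc_eq_integral_Ioo, ← intervalIntegral.integral_of_le hT]
  calc ∫ t in (0 : ℝ)..T, |deriv (fun t => a t * b t) t|
      ≤ ∫ t in (0 : ℝ)..T, (deriv a t - deriv b t) :=
        intervalIntegral.integral_mono_on hT (hcab.abs.intervalIntegrable _ _)
          ((hca.sub hcb).intervalIntegrable _ _) fun t _ => hle t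
    _ = (a T - a 0) - (b T - b 0) := by
        rw [intervalIntegral.integral_sub (hca.intervalIntegrable _ _)
          (hcb.intervalIntegrable _ _),
          intervalIntegral.integral_deriv_eq_sub (fun t _ => hda t) (hca.intervalIntegrable _ _),
          intervalIntegral.integral_deriv_eq_sub (fun t _ => hdb t) (hcb.intervalIntegrable _ _)]
    _ ≤ 2 := by linarith [ha0 0, ha1 T, hb0 T, hb1 0]

/-- A smooth cutoff supported in `(0, T)`, equal to `1` on `[2ε, T - 2ε]`, of variation at
most `2`. -/
theorem exists_contDiff_plateau {T ε : ℝ} (hT : 0 ≤ T) (hε : 0 < ε) :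
    ∃ η : ℝ → ℝ, ContDiff ℝ (⊤ : ℕ∞) η ∧ HasCompactSupport η ∧ tsupport η ⊆ Set.Ioo 0 T ∧
      (∀ t, 0 ≤ η t) ∧ (∀ t, η t ≤ 1) ∧ (∀ t ∈ Set.Icc (2 * ε) (T - 2 * ε), η t = 1) ∧
      ∫ t in Set.Ioo 0 T, |deriv η t| ≤ 2 := by
  set a : ℝ → ℝ := fun t => Real.smoothTransition (t / ε - 1) with ha_def
  set b : ℝ → ℝ := fun t => Real.smoothTransition ((T - t) / ε - 1) with hb_def
  have ha : ∀ n : ℕ∞, ContDiff ℝ n a := fun n =>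
    Real.smoothTransition.contDiff.comp ((contDiff_id.div_const ε).sub contDiff_const)
  have hb : ∀ n : ℕ∞, ContDiff ℝ n b := fun n =>
    Real.smoothTransition.contDiff.comp
      (((contDiff_const.sub contDiff_id).div_const ε).sub contDiff_const)
  have ha_mono : Monotone a := fun x y hxy => Real.smoothTransition.monotone (by gcongr)
  have hb_anti : Antitone b := fun x y hxy => Real.smoothTransition.monotone (by gcongr)
  have ha0 : ∀ t, 0 ≤ a t := fun t => Real.smoothTransition.nonneg _
  have hb0 : ∀ t, 0 ≤ b t := fun t => Real.smoothTransition.nonneg _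
  have ha1 : ∀ t, a t ≤ 1 := fun t => Real.smoothTransition.le_one _
  have hb1 : ∀ t, b t ≤ 1 := fun t => Real.smoothTransition.le_one _
  have hsupp : Function.support (fun t => a t * b t) ⊆ Set.Icc ε (T - ε) := by
    intro t ht
    obtain ⟨hat, hbt⟩ := mul_ne_zero_iff.1 (Function.mem_support.1 ht)
    simp only [ha_def, hb_def, ne_eq, Real.smoothTransition.zero_iff_nonpos, not_le, sub_pos,
      one_lt_div hε] at hat hbt
    exact ⟨hat.le, by linarith⟩
  refine ⟨fun t => a t * b t, (ha ⊤).mul (hb ⊤),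
    HasCompactSupport.of_support_subset_isCompact isCompact_Icc hsupp,
    (closure_minimal hsupp isClosed_Icc).trans fun t ht =>
      ⟨by linarith [ht.1], by linarith [ht.2]⟩,
    fun t => mul_nonneg (ha0 t) (hb0 t), fun t => mul_le_one₀ (ha1 t) (hb0 t) (hb1 t), ?_,
    integral_abs_deriv_mul_le_two hT (ha 1) (hb 1) ha_mono hb_anti ha0 ha1 hb0 hb1⟩
  rintro t ⟨h1, h2⟩
  have h3 : a t = 1 := Real.smoothTransition.one_of_one_le (by
    rw [le_sub_iff_add_le, le_div_iff₀ hε]; linarith)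
  have h4 : b t = 1 := Real.smoothTransition.one_of_one_le (by
    rw [le_sub_iff_add_le, le_div_iff₀ hε]; linarith)
  simp [h3, h4]

/-- The interval `(0, T)` is the increasing union of the intervals `[2/(n+1), T - 2/(n+1)]`. -/
theorem iUnion_Icc_two_mul_one_div (T : ℝ) :
    ⋃ n : ℕ, Set.Icc (2 * (1 / ((n : ℝ) + 1))) (T - 2 * (1 / ((n : ℝ) + 1))) = Set.Ioo 0 T := by
  ext t
  simp only [Set.mem_iUnion, Set.mem_Icc, Set.mem_Ioo]
  constructor
  · rintro ⟨n, h1, h2⟩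
    have hn : (0 : ℝ) < 1 / ((n : ℝ) + 1) := Nat.one_div_pos_of_nat
    exact ⟨by linarith, by linarith⟩
  · rintro ⟨h1, h2⟩
    obtain ⟨n, hn⟩ := exists_nat_one_div_lt (half_pos (lt_min h1 (sub_pos.2 h2)))
    have h3 := min_le_left t (T - t)
    have h4 := min_le_right t (T - t)
    exact ⟨n, by linarith, by linarith⟩

/-- Let `T > 0`, `C > 0`, and let `g : (0,T) → [0,∞]` be
measurable. Suppose that for every smooth `η : ℝ → ℝ` with compact support
contained in `(0,T)` and `0 ≤ η ≤ 1`, one has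
`∫_0^T η t * g t dt ≤ C * (sup_t |η t| + ∫_0^T |η' t| dt)`.
Then `∫_0^T g t dt ≤ 3 C`. -/
theorem stmt14 (T C : ℝ) (hT : 0 < T) (hC : 0 < C)
    (g : ℝ → ℝ≥0∞) (hg : Measurable ((Set.Ioo (0 : ℝ) T).restrict g))
    (H : ∀ η : ℝ → ℝ, ContDiff ℝ (⊤ : ℕ∞) η → HasCompactSupport η →
      tsupport η ⊆ Set.Ioo 0 T → (∀ t, 0 ≤ η t) → (∀ t, η t ≤ 1) →
      ∫⁻ t in Set.Ioo 0 T, ENNReal.ofReal (η t) * g t ≤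
        ENNReal.ofReal (C * ((⨆ t : ℝ, |η t|) + ∫ t in Set.Ioo 0 T, |deriv η t|))) :
    ∫⁻ t in Set.Ioo 0 T, g t ≤ ENNReal.ofReal (3 * C) := by
  rw [← iUnion_Icc_two_mul_one_div T, setLIntegral_iUnion_of_directed]
  swap
  · refine directed_of_isDirected_le fun m n hmn => ?_
    have h := Nat.one_div_le_one_div (α := ℝ) hmn
    exact Set.Icc_subset_Icc (by linarith) (by linarith)
  refine iSup_le fun n => ?_
  obtain ⟨η, hη, hηc, hηs, hη0, hη1, hη_one, hη_var⟩ :=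
    exists_contDiff_plateau hT.le (Nat.one_div_pos_of_nat (α := ℝ) (n := n))
  have hsup : ⨆ t : ℝ, |η t| ≤ 1 := ciSup_le fun t => by
    rw [abs_of_nonneg (hη0 t)]; exact hη1 t
  have hsub : Set.Icc (2 * (1 / ((n : ℝ) + 1))) (T - 2 * (1 / ((n : ℝ) + 1))) ⊆ Set.Ioo 0 T := by
    rw [← iUnion_Icc_two_mul_one_div T]
    exact Set.subset_iUnion
      (fun n : ℕ => Set.Icc (2 * (1 / ((n : ℝ) + 1))) (T - 2 * (1 / ((n : ℝ) + 1)))) n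
  calc ∫⁻ t in Set.Icc (2 * (1 / ((n : ℝ) + 1))) (T - 2 * (1 / ((n : ℝ) + 1))), g t
      = ∫⁻ t in Set.Icc (2 * (1 / ((n : ℝ) + 1))) (T - 2 * (1 / ((n : ℝ) + 1))),
          ENNReal.ofReal (η t) * g t :=
        setLIntegral_congr_fun measurableSet_Icc fun t ht => by simp [hη_one t ht]
    _ ≤ ∫⁻ t in Set.Ioo 0 T, ENNReal.ofReal (η t) * g t := lintegral_mono_set hsub
    _ ≤ ENNReal.ofReal (C * ((⨆ t : ℝ, |η t|) + ∫ t in Set.Ioo 0 T, |deriv η t|)) :=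
        H η hη hηc hηs hη0 hη1
    _ ≤ ENNReal.ofReal (3 * C) := ENNReal.ofReal_le_ofReal (by nlinarith)
end
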